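/- Let (Ω, 𝒜, P) be a probability space. For each label e ∈ {1, 2} (two decisions), let Y_e, Y′_e, Y^σ_e, Y^{σ′}_e : Ω → [0,1] and Z_e, R_e, R′_e, Z^σ_e, R^σ_e, R^{σ′}_e be random variables with values z, r such that all events {Z_e = z}, {R_e = r}, {R′_e = r}, {Z^σ_e = z}, {R^σ_e = r}, {R^{σ′}_e = r} are measurable. Assume for each e: (a) source consistency: P-almost surely on {Z_e = z}, Y′_e = Y_e and R′_e = R_e; (b) shifted consistency: P-almost surely on {Z^σ_e = z}, Y^{σ′}_e = Y^σ_e and R^{σ′}_e = R^σ_e; (c) invariance of do(z)-quantities under the shift: E[Y^{σ′}_e·1_{R^{σ′}_e = r}] = E[Y′_e·1_{R′_e = r}] and P(R^{σ′}_e = r) = P(R′_e = r); (d) P(Z^σ_e = z, R^σ_e = r) > 0. Then E[Y^σ_1·1_{Z^σ_1 = z}·1_{R^σ_1 = r}] / P(Z^σ_1 = z, R^σ_1 = r) − E[Y^σ_2·1_{Z^σ_2 = z}·1_{R^σ_2 = r}] / P(Z^σ_2 = z, R^σ_2 = r) ≥ ( P(Z^σ_1 = z, R^σ_1 = r) − P(Z_1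 = z, R_1 = r) + E[Y_1·1_{Z_1 = z}·1_{R_1 = r}] − 1 + P(Z_1 = z) ) / P(Z^σ_1 = z, R^σ_1 = r) − ( E[Y_2·1_{Z_2 = z}·1_{R_2 = r}] + 1 − P(Z_2 = z) ) / P(Z^σ_2 = z, R^σ_2 = r). -/

import Mathlib

open MeasureTheory

/-- Indicator function of a set, real-valued. -/
noncomputable def ind {Ω : Type*} (s : Set Ω) (ω : Ω) : ℝ :=
  s.indicator (fun _ => (1 : ℝ)) ω

theorem aux_ind_meas {Ω : Type*} [MeasurableSpace Ω] {s : Set Ω} (hs : MeasurableSet s) :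
    Measurable (ind s) := by
  unfold ind
  exact measurable_const.indicator hs

theorem aux_ind01 {Ω : Type*} (s : Set Ω) (ω : Ω) : 0 ≤ ind s ω ∧ ind s ω ≤ 1 := by
  unfold ind
  by_cases h : ω ∈ s <;> simp [h]

theorem aux_int {Ω : Type*} [MeasurableSpace Ω] (P : Measure Ω) [IsProbabilityMeasure P]
    {f : Ω → ℝ} (hf : Measurable f) (h : ∀ ω, 0 ≤ f ω ∧ f ω ≤ 1) : Integrable f P := by
  refine Integrable.of_bound hf.aestronglyMeasurable 1 (Filter.Eventually.of_forall fun ω => ?_)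
  rw [Real.norm_eq_abs, abs_of_nonneg (h ω).1]
  exact (h ω).2

theorem aux_mul01 {a b : ℝ} (ha : 0 ≤ a ∧ a ≤ 1) (hb : 0 ≤ b ∧ b ≤ 1) :
    0 ≤ a * b ∧ a * b ≤ 1 :=
  ⟨mul_nonneg ha.1 hb.1, mul_le_one₀ ha.2 hb.1 hb.2⟩

theorem aux_ind_int {Ω : Type*} [MeasurableSpace Ω] (P : Measure Ω) {s : Set Ω}
    (hs : MeasurableSet s) : ∫ ω, ind s ω ∂P = (P s).toReal := by
  unfold ind
  rw [integral_indicator_const (1 : ℝ) hs]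
  simp [Measure.real]

theorem aux_ind_and {Ω γ ρ : Type*} (Z : Ω → γ) (R : Ω → ρ) (z : γ) (r : ρ) (ω : Ω) :
    ind {ω' | Z ω' = z} ω * ind {ω' | R ω' = r} ω = ind {ω' | Z ω' = z ∧ R ω' = r} ω := by
  unfold ind
  by_cases h : Z ω = z <;> by_cases h' : R ω = r <;> simp [Set.indicator, h, h']

theorem aux_upper {Ω : Type*} [MeasurableSpace Ω] (P : Measure Ω) [IsProbabilityMeasure P]
    {γ ρ : Type*} (Y Y' Ys Ys' : Ω → ℝ) (Z Zs : Ω → γ) (R R' Rs Rs' : Ω → ρ) (z : γ) (r : ρ)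
    (hYm : Measurable Y) (hY'm : Measurable Y') (hYsm : Measurable Ys) (hYs'm : Measurable Ys')
    (hY : ∀ ω, 0 ≤ Y ω ∧ Y ω ≤ 1) (hY' : ∀ ω, 0 ≤ Y' ω ∧ Y' ω ≤ 1)
    (hYs : ∀ ω, 0 ≤ Ys ω ∧ Ys ω ≤ 1) (hYs' : ∀ ω, 0 ≤ Ys' ω ∧ Ys' ω ≤ 1)
    (hZ : MeasurableSet {ω | Z ω = z}) (hZs : MeasurableSet {ω | Zs ω = z})
    (hR : MeasurableSet {ω | R ω = r}) (hR' : MeasurableSet {ω | R' ω = r})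
    (hRs : MeasurableSet {ω | Rs ω = r}) (hRs' : MeasurableSet {ω | Rs' ω = r})
    (ha : ∀ᵐ ω ∂P, Z ω = z → Y' ω = Y ω ∧ R' ω = R ω)
    (hb : ∀ᵐ ω ∂P, Zs ω = z → Ys' ω = Ys ω ∧ Rs' ω = Rs ω)
    (hc : ∫ ω, Ys' ω * ind {ω' | Rs' ω' = r} ω ∂P
        = ∫ ω, Y' ω * ind {ω' | R' ω' = r} ω ∂P) :
    ∫ ω, Ys ω * ind {ω' | Zs ω' = z} ω * ind {ω' | Rs ω' = r} ω ∂P ≤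
      (∫ ω, Y ω * ind {ω' | Z ω' = z} ω * ind {ω' | R ω' = r} ω ∂P)
        + 1 - (P {ω | Z ω = z}).toReal := by
  have i1 : Integrable (fun ω => Ys ω * ind {ω' | Zs ω' = z} ω * ind {ω' | Rs ω' = r} ω) P :=
    aux_int P ((hYsm.mul (aux_ind_meas hZs)).mul (aux_ind_meas hRs))
      fun ω => aux_mul01 (aux_mul01 (hYs ω) (aux_ind01 _ ω)) (aux_ind01 _ ω)
  have i2 : Integrable (fun ω => Ys' ω * ind {ω' | Rs' ω' = r} ω) P :=
    aux_int P (hYs'm.mul (aux_ind_meas hRs')) fun ω => aux_mul01 (hYs' ω) (aux_ind01 _ ω)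
  have i3 : Integrable (fun ω => Y' ω * ind {ω' | R' ω' = r} ω) P :=
    aux_int P (hY'm.mul (aux_ind_meas hR')) fun ω => aux_mul01 (hY' ω) (aux_ind01 _ ω)
  have i4 : Integrable (fun ω => Y ω * ind {ω' | Z ω' = z} ω * ind {ω' | R ω' = r} ω) P :=
    aux_int P ((hYm.mul (aux_ind_meas hZ)).mul (aux_ind_meas hR))
      fun ω => aux_mul01 (aux_mul01 (hY ω) (aux_ind01 _ ω)) (aux_ind01 _ ω)
  have i5 : Integrable (ind {ω' | Z ω' = z}) P :=
    aux_int P (aux_ind_meas hZ) (aux_ind01 _)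
  have i6 : Integrable (fun _ : Ω => (1 : ℝ)) P := integrable_const _
  have s1 : ∫ ω, Ys ω * ind {ω' | Zs ω' = z} ω * ind {ω' | Rs ω' = r} ω ∂P ≤
      ∫ ω, Ys' ω * ind {ω' | Rs' ω' = r} ω ∂P := by
    refine integral_mono_ae i1 i2 ?_
    filter_upwards [hb] with ω h
    by_cases hz : Zs ω = z
    · obtain ⟨e1, e2⟩ := h hz
      by_cases hr : Rs ω = r
      · have hr' : Rs' ω = r := e2.trans hr
        simp [ind, Set.indicator, hz, e1, hr, hr']
      · have hr' : ¬ Rs' ω = r := fun h' => hr (e2.symm.trans h')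
        simp [ind, Set.indicator, hz, hr, hr']
    · have := aux_mul01 (hYs' ω) (aux_ind01 {ω' | Rs' ω' = r} ω)
      have h0 : ind {ω' | Zs ω' = z} ω = 0 := by simp [ind, Set.indicator, hz]
      simp only [h0]
      linarith [this.1]
  have s2 : ∫ ω, Y' ω * ind {ω' | R' ω' = r} ω ∂P ≤
      ∫ ω, (Y ω * ind {ω' | Z ω' = z} ω * ind {ω' | R ω' = r} ω
        + (1 - ind {ω' | Z ω' = z} ω)) ∂P := by
    refine integral_mono_ae i3 (i4.add (i6.sub i5)) ?_
    filter_upwards [ha] with ω h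
    by_cases hz : Z ω = z
    · obtain ⟨e1, e2⟩ := h hz
      by_cases hr : R ω = r
      · have hr' : R' ω = r := e2.trans hr
        simp [ind, Set.indicator, hz, e1, hr, hr']
      · have hr' : ¬ R' ω = r := fun h' => hr (e2.symm.trans h')
        simp [ind, Set.indicator, hz, hr, hr']
    · have := aux_mul01 (hY' ω) (aux_ind01 {ω' | R' ω' = r} ω)
      have h0 : ind {ω' | Z ω' = z} ω = 0 := by simp [ind, Set.indicator, hz]
      simp only [h0]
      linarith [this.2]
  have i7 : Integrable (fun ω => 1 - ind {ω' | Z ω' = z} ω) P := i6.sub i5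
  rw [integral_add i4 i7, integral_sub i6 i5, aux_ind_int P hZ] at s2
  simp only [integral_const, probReal_univ, smul_eq_mul, mul_one] at s2
  linarith

theorem aux_compl {Ω : Type*} [MeasurableSpace Ω] (P : Measure Ω) [IsProbabilityMeasure P]
    {γ ρ : Type*} (Y : Ω → ℝ) (Z : Ω → γ) (R : Ω → ρ) (z : γ) (r : ρ) (hYm : Measurable Y)
    (hY : ∀ ω, 0 ≤ Y ω ∧ Y ω ≤ 1)
    (hZ : MeasurableSet {ω | Z ω = z}) (hR : MeasurableSet {ω | R ω = r}) :
    ∫ ω, (1 - Y ω) * ind {ω' | Z ω' = z} ω * ind {ω' | R ω' = r} ω ∂P =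
      (P {ω | Z ω = z ∧ R ω = r}).toReal
        - ∫ ω, Y ω * ind {ω' | Z ω' = z} ω * ind {ω' | R ω' = r} ω ∂P := by
  have hZR : MeasurableSet {ω | Z ω = z ∧ R ω = r} := hZ.inter hR
  rw [← aux_ind_int P hZR, ← integral_sub]
  · congr 1
    ext ω
    rw [← aux_ind_and]
    ring
  · exact aux_int P (aux_ind_meas hZR) (aux_ind01 _)
  · exact aux_int P ((hYm.mul (aux_ind_meas hZ)).mul (aux_ind_meas hR))
      fun ω => aux_mul01 (aux_mul01 (hY ω) (aux_ind01 _ ω)) (aux_ind01 _ ω)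

theorem aux_compl' {Ω : Type*} [MeasurableSpace Ω] (P : Measure Ω) [IsProbabilityMeasure P]
    {ρ : Type*} (Y : Ω → ℝ) (R : Ω → ρ) (r : ρ) (hYm : Measurable Y)
    (hY : ∀ ω, 0 ≤ Y ω ∧ Y ω ≤ 1) (hR : MeasurableSet {ω | R ω = r}) :
    ∫ ω, (1 - Y ω) * ind {ω' | R ω' = r} ω ∂P =
      (P {ω | R ω = r}).toReal - ∫ ω, Y ω * ind {ω' | R ω' = r} ω ∂P := by
  rw [← aux_ind_int P hR, ← integral_sub]
  · congr 1
    ext ω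
    ring
  · exact aux_int P (aux_ind_meas hR) (aux_ind01 _)
  · exact aux_int P (hYm.mul (aux_ind_meas hR)) fun ω => aux_mul01 (hY ω) (aux_ind01 _ ω)

theorem aux_one_sub {a : ℝ} (h : 0 ≤ a ∧ a ≤ 1) : 0 ≤ 1 - a ∧ 1 - a ≤ 1 :=
  ⟨by linarith [h.2], by linarith [h.1]⟩

theorem stmt_8 {Ω : Type*} [MeasurableSpace Ω] (P : Measure Ω) [IsProbabilityMeasure P]
    {γ ρ : Type*}
    (Y₁ Y₁' Ys₁ Ys₁' Y₂ Y₂' Ys₂ Ys₂' : Ω → ℝ)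
    (Z₁ Zs₁ Z₂ Zs₂ : Ω → γ) (R₁ R₁' Rs₁ Rs₁' R₂ R₂' Rs₂ Rs₂' : Ω → ρ)
    (z : γ) (r : ρ)
    (hY₁m : Measurable Y₁) (hY₁'m : Measurable Y₁')
    (hYs₁m : Measurable Ys₁) (hYs₁'m : Measurable Ys₁')
    (hY₂m : Measurable Y₂) (hY₂'m : Measurable Y₂')
    (hYs₂m : Measurable Ys₂) (hYs₂'m : Measurable Ys₂')
    (hY₁01 : ∀ ω, 0 ≤ Y₁ ω ∧ Y₁ ω ≤ 1) (hY₁'01 : ∀ ω, 0 ≤ Y₁' ω ∧ Y₁' ω ≤ 1)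
    (hYs₁01 : ∀ ω, 0 ≤ Ys₁ ω ∧ Ys₁ ω ≤ 1) (hYs₁'01 : ∀ ω, 0 ≤ Ys₁' ω ∧ Ys₁' ω ≤ 1)
    (hY₂01 : ∀ ω, 0 ≤ Y₂ ω ∧ Y₂ ω ≤ 1) (hY₂'01 : ∀ ω, 0 ≤ Y₂' ω ∧ Y₂' ω ≤ 1)
    (hYs₂01 : ∀ ω, 0 ≤ Ys₂ ω ∧ Ys₂ ω ≤ 1) (hYs₂'01 : ∀ ω, 0 ≤ Ys₂' ω ∧ Ys₂' ω ≤ 1)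
    (hZ₁ : MeasurableSet {ω | Z₁ ω = z}) (hZs₁ : MeasurableSet {ω | Zs₁ ω = z})
    (hZ₂ : MeasurableSet {ω | Z₂ ω = z}) (hZs₂ : MeasurableSet {ω | Zs₂ ω = z})
    (hR₁ : MeasurableSet {ω | R₁ ω = r}) (hR₁' : MeasurableSet {ω | R₁' ω = r})
    (hRs₁ : MeasurableSet {ω | Rs₁ ω = r}) (hRs₁' : MeasurableSet {ω | Rs₁' ω = r})
    (hR₂ : MeasurableSet {ω | R₂ ω = r}) (hR₂' : MeasurableSet {ω | R₂' ω = r})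
    (hRs₂ : MeasurableSet {ω | Rs₂ ω = r}) (hRs₂' : MeasurableSet {ω | Rs₂' ω = r})
    -- (a) source consistency
    (ha₁ : ∀ᵐ ω ∂P, Z₁ ω = z → Y₁' ω = Y₁ ω ∧ R₁' ω = R₁ ω)
    (ha₂ : ∀ᵐ ω ∂P, Z₂ ω = z → Y₂' ω = Y₂ ω ∧ R₂' ω = R₂ ω)
    -- (b) shifted consistency
    (hb₁ : ∀ᵐ ω ∂P, Zs₁ ω = z → Ys₁' ω = Ys₁ ω ∧ Rs₁' ω = Rs₁ ω)
    (hb₂ : ∀ᵐ ω ∂P, Zs₂ ω = z → Ys₂' ω = Ys₂ ω ∧ Rs₂' ω = Rs₂ ω)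
    -- (c) invariance of do(z)-quantities under the shift
    (hc₁E : ∫ ω, Ys₁' ω * ind {ω' | Rs₁' ω' = r} ω ∂P
        = ∫ ω, Y₁' ω * ind {ω' | R₁' ω' = r} ω ∂P)
    (hc₁P : (P {ω | Rs₁' ω = r}).toReal = (P {ω | R₁' ω = r}).toReal)
    (hc₂E : ∫ ω, Ys₂' ω * ind {ω' | Rs₂' ω' = r} ω ∂P
        = ∫ ω, Y₂' ω * ind {ω' | R₂' ω' = r} ω ∂P)
    (hc₂P : (P {ω | Rs₂' ω = r}).toReal = (P {ω | R₂' ω = r}).toReal)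
    -- (d) positivity
    (hd₁ : 0 < (P {ω | Zs₁ ω = z ∧ Rs₁ ω = r}).toReal)
    (hd₂ : 0 < (P {ω | Zs₂ ω = z ∧ Rs₂ ω = r}).toReal) :
    (∫ ω, Ys₁ ω * ind {ω' | Zs₁ ω' = z} ω * ind {ω' | Rs₁ ω' = r} ω ∂P)
        / (P {ω | Zs₁ ω = z ∧ Rs₁ ω = r}).toReal
      - (∫ ω, Ys₂ ω * ind {ω' | Zs₂ ω' = z} ω * ind {ω' | Rs₂ ω' = r} ω ∂P)
          / (P {ω | Zs₂ ω = z ∧ Rs₂ ω = r}).toReal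
      ≥ ((P {ω | Zs₁ ω = z ∧ Rs₁ ω = r}).toReal - (P {ω | Z₁ ω = z ∧ R₁ ω = r}).toReal
            + (∫ ω, Y₁ ω * ind {ω' | Z₁ ω' = z} ω * ind {ω' | R₁ ω' = r} ω ∂P)
            - 1 + (P {ω | Z₁ ω = z}).toReal)
          / (P {ω | Zs₁ ω = z ∧ Rs₁ ω = r}).toReal
        - ((∫ ω, Y₂ ω * ind {ω' | Z₂ ω' = z} ω * ind {ω' | R₂ ω' = r} ω ∂P)
              + 1 - (P {ω | Z₂ ω = z}).toReal)
            / (P {ω | Zs₂ ω = z ∧ Rs₂ ω = r}).toReal := by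
  have u2 := aux_upper P Y₂ Y₂' Ys₂ Ys₂' Z₂ Zs₂ R₂ R₂' Rs₂ Rs₂' z r hY₂m hY₂'m hYs₂m hYs₂'m
    hY₂01 hY₂'01 hYs₂01 hYs₂'01 hZ₂ hZs₂ hR₂ hR₂' hRs₂ hRs₂' ha₂ hb₂ hc₂E
  have u1 := aux_upper P (fun ω => 1 - Y₁ ω) (fun ω => 1 - Y₁' ω) (fun ω => 1 - Ys₁ ω)
    (fun ω => 1 - Ys₁' ω) Z₁ Zs₁ R₁ R₁' Rs₁ Rs₁' z r
    (hY₁m.const_sub 1) (hY₁'m.const_sub 1) (hYs₁m.const_sub 1) (hYs₁'m.const_sub 1)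
    (fun ω => aux_one_sub (hY₁01 ω)) (fun ω => aux_one_sub (hY₁'01 ω))
    (fun ω => aux_one_sub (hYs₁01 ω)) (fun ω => aux_one_sub (hYs₁'01 ω))
    hZ₁ hZs₁ hR₁ hR₁' hRs₁ hRs₁'
    (ha₁.mono fun ω h hz => ⟨by rw [(h hz).1], (h hz).2⟩)
    (hb₁.mono fun ω h hz => ⟨by rw [(h hz).1], (h hz).2⟩)
    (by rw [aux_compl' P Ys₁' Rs₁' r hYs₁'m hYs₁'01 hRs₁',
          aux_compl' P Y₁' R₁' r hY₁'m hY₁'01 hR₁', hc₁E, hc₁P])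
  rw [aux_compl P Ys₁ Zs₁ Rs₁ z r hYs₁m hYs₁01 hZs₁ hRs₁,
    aux_compl P Y₁ Z₁ R₁ z r hY₁m hY₁01 hZ₁ hR₁] at u1
  refine sub_le_sub ?_ ?_
  · refine div_le_div_of_nonneg_right ?_ hd₁.le
    linarith
  · exact div_le_div_of_nonneg_right u2 hd₂.le
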